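/- arXiv:2411.19173 — 4 statements merged into one kernel-verified Lean document; each statement's English description precedes it below -/
import Mathlib

section
/- For every integer s ≥ 2 there exist a constant c > 0 and a threshold n₀ (depending only on s) such that for every integer n ≥ n₀, every K_{s,s}-free simple graph G that contains a path on n vertices contains an induced path on at least c · (log log n)/(log log log n) vertices. -/
/-- A graph is `K_{s,s}`-free if it does not contain the complete bipartite graph `K_{s,s}`
as a (not necessarily induced) subgraph, i.e. there are no two disjoint `s`-sets of vertices
with all edges between them present. -/
def KssFree {V : Type*} (G : SimpleGraph V) (s : ℕ) : Prop :=
  ¬ ∃ (A B : Finset V), Disjoint A B ∧ A.card = s ∧ B.card = s ∧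
      ∀ a ∈ A, ∀ b ∈ B, G.Adj a b

/-- `G` contains a path on `n` vertices: a sequence of `n` distinct vertices in which
consecutive vertices are adjacent. -/
def HasPathOn {V : Type*} (G : SimpleGraph V) (n : ℕ) : Prop :=
  ∃ f : Fin n → V, Function.Injective f ∧
    ∀ i j : Fin n, (j : ℕ) = (i : ℕ) + 1 → G.Adj (f i) (f j)

/-- `G` contains an induced path on `k` vertices: `k` distinct vertices such that two of them
are adjacent in `G` if and only if they are consecutive. -/
def HasInducedPathOn {V : Type*} (G : SimpleGraph V) (k : ℕ) : Prop :=
  ∃ f : Fin k → V, Function.Injective f ∧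
    ∀ i j : Fin k, i < j → (G.Adj (f i) (f j) ↔ (j : ℕ) = (i : ℕ) + 1)

/-- One step inside `C` along an edge of `G`. -/
def StepIn {V : Type*} (G : SimpleGraph V) (C : Set V) (a b : V) : Prop :=
  G.Adj a b ∧ b ∈ C

/-- A walk inside `C` that ends in `A` has a first vertex in `A`. -/
lemma StepIn.exists_first_hit {V : Type*} {G : SimpleGraph V} {C A : Set V} {w y : V}
    (hw : w ∉ A) (hy : y ∈ A) (h : Relation.ReflTransGen (StepIn G C) w y) :
    ∃ a b, Relation.ReflTransGen (StepIn G (C \ A)) w a ∧ a ∉ A ∧ G.Adj a b ∧ b ∈ A ∧ b ∈ C := by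
  have key : (Relation.ReflTransGen (StepIn G (C \ A)) w y ∧ y ∉ A) ∨
      ∃ a b, Relation.ReflTransGen (StepIn G (C \ A)) w a ∧ a ∉ A ∧ G.Adj a b ∧ b ∈ A ∧ b ∈ C := by
    clear hy
    induction h with
    | refl => exact Or.inl ⟨.refl, hw⟩
    | tail _ hbc ih =>
      rename_i b c _
      rcases ih with ⟨hb, hbA⟩ | ih
      · by_cases hc : c ∈ A
        · exact Or.inr ⟨b, c, hb, hbA, hbc.1, hc, hbc.2⟩
        · exact Or.inl ⟨hb.tail ⟨hbc.1, hbc.2, hc⟩, hc⟩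
      · exact Or.inr ih
  exact key.resolve_left fun h => h.2 hy

/-- Among `d + 2` consecutive blocks of length `q`, one avoids a given set of at most `d + 1`
elements. -/
lemma exists_block_avoiding {V : Type*} {d p q : ℕ} {f : ℕ → V}
    (hinj : ∀ i < p, ∀ j < p, f i = f j → i = j) (hp : (d + 2) * q ≤ p)
    {A : Finset V} (hA : A.card ≤ d + 1) :
    ∃ j, j < d + 2 ∧ ∀ i < q, f (j * q + i) ∉ A := by
  by_contra! h
  choose! g hg using h
  have hlt : ∀ j < d + 2, j * q + g j < (d + 2) * q := fun j hj => by
    have h1 := (hg j hj).1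
    calc j * q + g j < (j + 1) * q := by rw [add_mul]; omega
      _ ≤ (d + 2) * q := Nat.mul_le_mul_right _ hj
  have hcard : (Finset.range (d + 2)).card ≤ A.card := by
    refine Finset.card_le_card_of_injOn (fun j => f (j * q + g j))
      (fun j hj => (hg j (by simpa using hj)).2) ?_
    intro a ha b hb hab
    have ha' : a < d + 2 := by simpa using ha
    have hb' : b < d + 2 := by simpa using hb
    have e := hinj _ ((hlt a ha').trans_le hp) _ ((hlt b hb').trans_le hp) hab
    have h1 := (hg a ha').1
    have h2 := (hg b hb').1
    have := congrArg (· / q) e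
    have hq : 0 < q := by omega
    simpa [mul_comm _ q, Nat.mul_add_div hq, Nat.div_eq_of_lt h1, Nat.div_eq_of_lt h2] using this
  simp at hcard
  omega

/-- If the edges of `G` are oriented with out-neighbourhoods `N v` of size at most `d`, a long path
yields a path all of whose forward arcs, with respect to the orientation, join consecutive
vertices. -/
lemma exists_path_with_short_forward_arcs {V : Type*} {G : SimpleGraph V} {d : ℕ}
    {N : V → Finset V} (hN : ∀ v, (N v).card ≤ d) (hadj : ∀ v, ∀ u ∈ N v, G.Adj v u) (t : ℕ) :
    ∀ (C : Set V) (y : V) (p : ℕ) (f : ℕ → V), y ∈ C → (d + 2) ^ t ≤ p →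
      (∀ i < p, f i ∈ C) → (∀ i < p, ∀ j < p, f i = f j → i = j) →
      (∀ i, i + 1 < p → G.Adj (f i) (f (i + 1))) →
      (∀ i < p, Relation.ReflTransGen (StepIn G C) (f i) y) →
      ∃ g : ℕ → V, g 0 = y ∧ (∀ i ≤ t, g i ∈ C) ∧ (∀ i ≤ t, ∀ j ≤ t, g i = g j → i = j) ∧
        (∀ i < t, G.Adj (g i) (g (i + 1))) ∧ ∀ i j, i + 1 < j → j ≤ t → g j ∉ N (g i) := by
  classical
  induction t with
  | zero =>
    intro C y p f hy _ _ _ _ _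
    exact ⟨fun _ => y, rfl, fun _ _ => hy, fun i hi j hj _ => by omega, fun i hi => by omega,
      fun i j h1 h2 => by omega⟩
  | succ t ih =>
    intro C y p f hy hp hC hinj hf hreach
    set q := (d + 2) ^ t with hq
    have hq0 : 0 < q := by positivity
    have hp' : (d + 2) * q ≤ p := by rw [hq, ← pow_succ']; exact hp
    obtain ⟨j, hj, hblock⟩ := exists_block_avoiding hinj hp' (A := insert y (N y))
      ((Finset.card_insert_le _ _).trans (by have := hN y; omega))
    set A : Set V := ↑(insert y (N y)) with hA
    have hlt : ∀ i < q, j * q + i < p := fun i hi => by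
      calc j * q + i < (j + 1) * q := by rw [add_mul]; omega
        _ ≤ (d + 2) * q := Nat.mul_le_mul_right _ hj
        _ ≤ p := hp'
    have hbC : ∀ i < q, f (j * q + i) ∈ C \ A := fun i hi =>
      ⟨hC _ (hlt i hi), by simpa [hA] using hblock i hi⟩
    obtain ⟨a, b, hwa, haA, hab, hbA, hbC'⟩ := StepIn.exists_first_hit (hbC 0 hq0).2
      (by simp [hA] : y ∈ A) (hreach _ (hlt 0 hq0))
    -- the next vertex of the path and the set in which the path continues
    obtain ⟨y', C', hyy', hy'C', hCC', hsub, hr⟩ : ∃ y' C', G.Adj y y' ∧ y' ∈ C' ∧ C \ A ⊆ C' ∧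
        (C' ⊆ C ∧ ∀ v ∈ C', v ∈ A → v = y') ∧
        Relation.ReflTransGen (StepIn G C') (f (j * q + 0)) y' := by
      have haC : a ∈ C \ A := by
        rcases Relation.ReflTransGen.cases_tail hwa with h | ⟨c, _, h⟩
        · rw [h]; exact hbC 0 hq0
        · exact h.2
      by_cases hby : b = y
      · subst hby
        exact ⟨a, C \ A, hab.symm, haC, subset_rfl, ⟨Set.sdiff_subset, fun v hv hv' =>
          absurd hv' hv.2⟩, hwa⟩
      · refine ⟨b, insert b (C \ A), hadj y b ?_, Set.mem_insert _ _, Set.subset_insert _ _,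
          ⟨Set.insert_subset hbC' Set.sdiff_subset, ?_⟩, ?_⟩
        · simpa [hA, hby] using hbA
        · rintro v (rfl | hv) hv'
          · rfl
          · exact absurd hv' hv.2
        · exact (Relation.ReflTransGen.mono
            (fun u v h => ⟨h.1, Set.mem_insert_of_mem _ h.2⟩) _ _ hwa).tail
            ⟨hab, Set.mem_insert _ _⟩
    have hreach' : ∀ i < q, Relation.ReflTransGen (StepIn G C') (f (j * q + i)) y' := by
      intro i
      induction i with
      | zero => exact fun _ => hr
      | succ i ihi =>
        intro hi
        exact .head ⟨(hf _ (hlt (i + 1) hi)).symm, hCC' (hbC i (by omega))⟩ (ihi (by omega))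
    obtain ⟨g, hg0, hgC, hginj, hgadj, hgN⟩ := ih C' y' q (fun i => f (j * q + i)) hy'C' le_rfl
      (fun i hi => hCC' (hbC i hi))
      (fun i hi i' hi' h => by have := hinj _ (hlt i hi) _ (hlt i' hi') h; omega)
      (fun i hi => hf _ (hlt (i + 1) hi)) hreach'
    have hne : ∀ i ≤ t, g i ≠ y := fun i hi h => hyy'.ne
      ((hsub.2 y (h ▸ hgC i hi) (by simp [hA])))
    refine ⟨fun | 0 => y | i + 1 => g i, rfl, ?_, ?_, ?_, ?_⟩
    · rintro (_ | i) hi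
      · exact hy
      · exact hsub.1 (hgC i (by omega))
    · rintro (_ | i) hi (_ | j) hj h
      · rfl
      · exact absurd h.symm (hne j (by omega))
      · exact absurd h (hne i (by omega))
      · rw [hginj i (by omega) j (by omega) h]
    · rintro (_ | i) hi
      · simpa [hg0] using hyy'
      · exact hgadj i (by omega)
    · rintro (_ | i) (_ | j) h1 h2 h
      · omega
      · have := hsub.2 _ (hgC j (by omega)) (by simp [hA]; exact Or.inr h)
        have := hginj j (by omega) 0 (by omega) (by rw [this, hg0])
        omega
      · omega
      · exact hgN i j (by omega) (by omega) h

/-- A long path in which every vertex has at most `D` neighbours preceding it contains a long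
induced path. -/
lemma exists_inducedPath_of_few_back_neighbors {V : Type*} {G : SimpleGraph V} {D m k : ℕ}
    {f : ℕ → V} (hinj : ∀ i ≤ m, ∀ j ≤ m, f i = f j → i = j)
    (hadj : ∀ i < m, G.Adj (f i) (f (i + 1)))
    (hback : ∀ j ≤ m, ∃ S : Finset ℕ, S.card ≤ D ∧ ∀ i < j, G.Adj (f i) (f j) → i ∈ S)
    (hm : (D + 1) ^ k ≤ m) : HasInducedPathOn G k := by
  classical
  -- the last neighbour of each vertex along the path
  let par : ℕ → ℕ := fun i => if i < m then Nat.findGreatest (fun j => G.Adj (f i) (f j)) m else m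
  have par_le : ∀ i, par i ≤ m := fun i => by
    simp only [par]; split_ifs; exacts [Nat.findGreatest_le _, le_rfl]
  have par_adj : ∀ i < m, G.Adj (f i) (f (par i)) := fun i hi => by
    simp only [par, if_pos hi]
    exact Nat.findGreatest_spec (P := fun j => G.Adj (f i) (f j)) hi (hadj i hi)
  have par_max : ∀ i < m, ∀ j ≤ m, G.Adj (f i) (f j) → j ≤ par i := fun i hi j hj h => by
    simp only [par, if_pos hi]
    exact Nat.le_findGreatest hj h
  have par_gt : ∀ i < m, i < par i := fun i hi => par_max i hi (i + 1) hi (hadj i hi)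
  have count : ∀ t, ((Finset.range (m + 1)).filter fun i => par^[t] i = m).card ≤ (D + 1) ^ t := by
    intro t
    induction t with
    | zero =>
      refine (Finset.card_le_card (t := {m}) fun i hi => ?_).trans (by simp)
      simpa using (Finset.mem_filter.1 hi).2
    | succ t iht =>
      rw [pow_succ']
      refine (Finset.card_le_mul_card_image_of_maps_to (f := par)
        (t := (Finset.range (m + 1)).filter fun i => par^[t] i = m) ?_ (D + 1) ?_).trans
        (Nat.mul_le_mul_left _ iht)
      · intro i hi
        have := (Finset.mem_filter.1 hi).2
        rw [Function.iterate_succ_apply] at this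
        exact Finset.mem_filter.2 ⟨Finset.mem_range.2 (Nat.lt_succ_of_le (par_le i)), this⟩
      · intro j hj
        have hjm : j ≤ m := by
          have := Finset.mem_range.1 (Finset.mem_filter.1 hj).1; omega
        obtain ⟨S, hS, hSj⟩ := hback j hjm
        refine (Finset.card_le_card (t := insert m S) fun i hi => ?_).trans
          ((Finset.card_insert_le _ _).trans (by omega))
        obtain ⟨hi', rfl⟩ := Finset.mem_filter.1 hi
        have him := Finset.mem_range.1 (Finset.mem_filter.1 hi').1
        rcases eq_or_ne i m with h | h
        · exact Finset.mem_insert.2 (Or.inl h)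
        · have : i < m := by omega
          exact Finset.mem_insert_of_mem (hSj i (par_gt i this) (par_adj i this))
  obtain ⟨i, him, hi⟩ : ∃ i ≤ m, par^[k] i ≠ m := by
    by_contra! h
    have := count k
    rw [Finset.filter_true_of_mem fun i hi => h i (by simpa [Nat.lt_succ_iff] using hi)] at this
    simp at this
    omega
  have par_m : par m = m := by simp [par]
  have hltm : ∀ a ≤ k, par^[a] i < m := by
    intro a ha
    have hle : par^[a] i ≤ m := by
      cases a with
      | zero => exact him
      | succ a => rw [Function.iterate_succ_apply']; exact par_le _
    refine lt_of_le_of_ne hle fun h => hi ?_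
    obtain ⟨b, rfl⟩ := Nat.exists_eq_add_of_le' ha
    rw [Function.iterate_add_apply, h, Function.iterate_fixed par_m]
  have hmono : ∀ a b, a < b → b ≤ k → par^[a] i < par^[b] i := by
    intro a b hab
    induction b, hab using Nat.le_induction with
    | base =>
      intro h
      rw [Function.iterate_succ_apply']
      exact par_gt _ (hltm a (by omega))
    | succ b hb ihb =>
      intro h
      refine (ihb (by omega)).trans ?_
      rw [Function.iterate_succ_apply']
      exact par_gt _ (hltm b (by omega))
  refine ⟨fun a => f (par^[a] i), fun a b hab => ?_, fun a b hab => ⟨fun h => ?_, fun h => ?_⟩⟩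
  · have e := hinj _ (hltm a a.2.le).le _ (hltm b b.2.le).le hab
    rcases lt_trichotomy (a : ℕ) b with h | h | h
    · exact absurd e (hmono a b h b.2.le).ne
    · exact Fin.ext h
    · exact absurd e (hmono b a h a.2.le).ne'
  · have h1 := par_max _ (hltm a a.2.le) _ (hltm b b.2.le).le h
    rw [← Function.iterate_succ_apply' par] at h1
    by_contra hne
    have hab' : (a : ℕ) < b := hab
    exact absurd h1 (not_le.2 (hmono (a + 1) b (by omega) b.2.le))
  · simp only [h, Function.iterate_succ_apply']
    exact par_adj _ (hltm a a.2.le)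

/-- A graph whose edges can be oriented with all out-degrees at most `d` and which contains a path
on `(d + 2) ^ (d + 2) ^ k` vertices contains an induced path on `k` vertices. -/
lemma hasInducedPathOn_of_orientation {V : Type*} {G : SimpleGraph V} {d k n : ℕ}
    {N : V → Finset V} (hN : ∀ v, (N v).card ≤ d) (hadj : ∀ v, ∀ u ∈ N v, G.Adj v u)
    (horient : ∀ u v, G.Adj u v → u ∈ N v ∨ v ∈ N u)
    (hn : (d + 2) ^ (d + 2) ^ k ≤ n) (hG : HasPathOn G n) : HasInducedPathOn G k := by
  classical
  obtain ⟨f, hinj, hf⟩ := hG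
  have hn0 : 0 < n := lt_of_lt_of_le (by positivity) hn
  let f' : ℕ → V := fun i => if h : i < n then f ⟨i, h⟩ else f ⟨0, hn0⟩
  have hf' : ∀ i (h : i < n), f' i = f ⟨i, h⟩ := fun i h => dif_pos h
  have hadj' : ∀ i, i + 1 < n → G.Adj (f' i) (f' (i + 1)) := fun i hi => by
    rw [hf' i (by omega), hf' _ hi]; exact hf _ _ rfl
  have hreach : ∀ i < n, Relation.ReflTransGen (StepIn G Set.univ) (f' i) (f' 0) := by
    intro i
    induction i with
    | zero => exact fun _ => .refl
    | succ i ih => exact fun hi => .head ⟨(hadj' i hi).symm, trivial⟩ (ih (by omega))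
  obtain ⟨g, -, -, hginj, hgadj, hgN⟩ := exists_path_with_short_forward_arcs hN hadj ((d + 2) ^ k)
    Set.univ (f' 0) n f' trivial hn (fun _ _ => trivial)
    (fun i hi j hj h => by
      rw [hf' i hi, hf' j hj] at h; simpa using hinj h) hadj' hreach
  refine exists_inducedPath_of_few_back_neighbors (D := d + 1) hginj hgadj (fun j hj => ?_) le_rfl
  refine ⟨insert (j - 1) (((Finset.range j).filter fun i => g i ∈ N (g j))), ?_, ?_⟩
  · refine (Finset.card_insert_le _ _).trans (Nat.succ_le_succ (le_trans ?_ (hN (g j))))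
    refine Finset.card_le_card_of_injOn g (fun i hi => (Finset.mem_filter.1 hi).2) ?_
    intro a ha b hb hab
    have ha := Finset.mem_range.1 (Finset.mem_filter.1 ha).1
    have hb := Finset.mem_range.1 (Finset.mem_filter.1 hb).1
    exact hginj a (by omega) b (by omega) hab
  · intro i hi h
    rcases horient _ _ h with h | h
    · exact Finset.mem_insert_of_mem (Finset.mem_filter.2 ⟨Finset.mem_range.2 hi, h⟩)
    · refine Finset.mem_insert.2 (Or.inl ?_)
      by_contra hne
      exact hgN i j (by omega) hj h

/-- The sequence `x, y 0, y 1, …`. -/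
def consSeq {V : Type*} (x : V) (y : ℕ → V) : ℕ → V
  | 0 => x
  | n + 1 => y n

/-- The expectation of `F` over the `t`-step Markov chain with transition matrix `P` started
at a given point. -/
def walkExp {V : Type*} [Fintype V] (P : Matrix V V ℝ) : ℕ → ((ℕ → V) → ℝ) → V → ℝ
  | 0, F, x => F fun _ => x
  | t + 1, F, x => ∑ v, P x v * walkExp P t (fun y => F (consSeq x y)) v

section MarkovChain

variable {V : Type*} [Fintype V] {P : Matrix V V ℝ}

lemma walkExp_sum {ι : Type*} (S : Finset ι) (t : ℕ) (F : ι → (ℕ → V) → ℝ) (x : V) :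
    walkExp P t (fun y => ∑ i ∈ S, F i y) x = ∑ i ∈ S, walkExp P t (F i) x := by
  induction t generalizing F x with
  | zero => rfl
  | succ t ih =>
    simp only [walkExp, ih, Finset.mul_sum]
    exact Finset.sum_comm

lemma walkExp_const (h1 : ∀ x, ∑ v, P x v = 1) (t : ℕ) (c : ℝ) (x : V) :
    walkExp P t (fun _ => c) x = c := by
  induction t generalizing x with
  | zero => rfl
  | succ t ih => simp [walkExp, ih, ← Finset.sum_mul, h1]

/-- Some trajectory of the chain does at least as well as the expectation. -/
lemma exists_walk_le_walkExp (h0 : ∀ x v, 0 ≤ P x v) (h1 : ∀ x, ∑ v, P x v = 1) (t : ℕ)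
    (F : (ℕ → V) → ℝ) (x : V) :
    ∃ y : ℕ → V, y 0 = x ∧ (∀ i < t, 0 < P (y i) (y (i + 1))) ∧ F y ≤ walkExp P t F x := by
  induction t generalizing F x with
  | zero => exact ⟨fun _ => x, rfl, fun i hi => by omega, le_rfl⟩
  | succ t ih =>
    obtain ⟨v, hv, hle⟩ : ∃ v, 0 < P x v ∧
        walkExp P t (fun y => F (consSeq x y)) v ≤ walkExp P (t + 1) F x := by
      by_contra! h
      have hpos : ∃ v, 0 < P x v := by
        by_contra! h'
        have := Finset.sum_nonpos fun v (_ : v ∈ Finset.univ) => h' v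
        linarith [h1 x]
      have : ∑ v, P x v * walkExp P (t + 1) F x <
          ∑ v, P x v * walkExp P t (fun y => F (consSeq x y)) v := by
        refine Finset.sum_lt_sum (fun v _ => ?_) ?_
        · rcases (h0 x v).eq_or_lt with h' | h'
          · simp [← h']
          · exact mul_le_mul_of_nonneg_left (h v h').le h'.le
        · obtain ⟨v, hv⟩ := hpos
          exact ⟨v, Finset.mem_univ _, mul_lt_mul_of_pos_left (h v hv) hv⟩
      rw [← Finset.sum_mul, h1, one_mul] at this
      exact lt_irrefl _ this
    obtain ⟨y, hy0, hyP, hyF⟩ := ih (fun y => F (consSeq x y)) v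
    refine ⟨consSeq x y, rfl, ?_, hyF.trans hle⟩
    rintro (_ | i) hi
    · simpa [consSeq, hy0] using hv
    · exact hyP i (by omega)

variable [DecidableEq V]

lemma walkExp_apply (h1 : ∀ x, ∑ v, P x v = 1) (t j : ℕ) (hj : j ≤ t) (h : V → ℝ) (x : V) :
    walkExp P t (fun y => h (y j)) x = (P ^ j).mulVec h x := by
  induction t generalizing j x with
  | zero =>
    obtain rfl : j = 0 := by omega
    simp [walkExp]
  | succ t ih =>
    cases j with
    | zero => simp [walkExp, consSeq, walkExp_const h1, ← Finset.sum_mul, h1]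
    | succ j =>
      simp only [walkExp, consSeq, ih j (by omega)]
      rw [pow_succ', ← Matrix.mulVec_mulVec]
      rfl

lemma walkExp_apply_apply (h1 : ∀ x, ∑ v, P x v = 1) (t i r : ℕ) (hr : i + r ≤ t)
    (f : V → V → ℝ) (x : V) :
    walkExp P t (fun y => f (y i) (y (i + r))) x =
      (P ^ i).mulVec (fun u => (P ^ r).mulVec (f u) u) x := by
  induction i generalizing t x with
  | zero =>
    cases t with
    | zero =>
      obtain rfl : r = 0 := by omega
      simp [walkExp]
    | succ t =>
      rw [pow_zero, Matrix.one_mulVec, ← walkExp_apply h1 (t + 1) r (by omega)]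
      simp only [walkExp, consSeq, zero_add]
  | succ i ih =>
    cases t with
    | zero => omega
    | succ t =>
      simp only [walkExp, consSeq, show i + 1 + r = (i + r) + 1 by omega, ih t (by omega)]
      rw [pow_succ', ← Matrix.mulVec_mulVec]
      rfl

lemma pow_nonneg_of_nonneg (h0 : ∀ x v, 0 ≤ P x v) (r : ℕ) (x v : V) : 0 ≤ (P ^ r) x v := by
  induction r generalizing v with
  | zero => rw [pow_zero, Matrix.one_apply]; split_ifs <;> norm_num
  | succ r ih =>
    rw [pow_succ, Matrix.mul_apply]
    exact Finset.sum_nonneg fun w _ => mul_nonneg (ih w) (h0 w v)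

lemma sum_pow_eq_one (h1 : ∀ x, ∑ v, P x v = 1) (r : ℕ) (x : V) : ∑ v, (P ^ r) x v = 1 := by
  induction r with
  | zero => simp [Matrix.one_apply]
  | succ r ih =>
    simp_rw [pow_succ, Matrix.mul_apply]
    rw [Finset.sum_comm]
    simp_rw [← Finset.mul_sum, h1, mul_one, ih]

lemma pow_succ_apply_le (h0 : ∀ x v, 0 ≤ P x v) (h1 : ∀ x, ∑ v, P x v = 1) {δ : ℝ}
    (hδ : ∀ x v, P x v ≤ δ) (r : ℕ) (x v : V) : (P ^ (r + 1)) x v ≤ δ := by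
  rw [pow_succ, Matrix.mul_apply]
  calc ∑ w, (P ^ r) x w * P w v ≤ ∑ w, (P ^ r) x w * δ :=
        Finset.sum_le_sum fun w _ => mul_le_mul_of_nonneg_left (hδ w v)
          (pow_nonneg_of_nonneg h0 r x w)
    _ = δ := by rw [← Finset.sum_mul, sum_pow_eq_one h1, one_mul]

lemma detailed_balance_pow {π : V → ℝ} (hrev : ∀ u v, π u * P u v = π v * P v u) (r : ℕ)
    (u v : V) : π u * (P ^ r) u v = π v * (P ^ r) v u := by
  induction r generalizing u v with
  | zero =>
    rw [pow_zero, Matrix.one_apply, Matrix.one_apply]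
    rcases eq_or_ne u v with rfl | h
    · rfl
    · simp [h, h.symm]
  | succ r ih =>
    rw [pow_succ, Matrix.mul_apply, ← pow_succ, pow_succ', Matrix.mul_apply, Finset.mul_sum,
      Finset.mul_sum]
    refine Finset.sum_congr rfl fun w _ => ?_
    rw [← mul_assoc, ih, mul_right_comm, hrev, mul_right_comm, mul_assoc,
      mul_comm ((P ^ r) w u)]

/-- A reversing measure is stationary. -/
lemma sum_mul_mulVec_pow {π : V → ℝ} (h1 : ∀ x, ∑ v, P x v = 1)
    (hrev : ∀ u v, π u * P u v = π v * P v u) (r : ℕ) (h : V → ℝ) :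
    ∑ x, π x * (P ^ r).mulVec h x = ∑ x, π x * h x := by
  simp only [Matrix.mulVec, dotProduct, Finset.mul_sum, ← mul_assoc]
  rw [Finset.sum_comm]
  refine Finset.sum_congr rfl fun v _ => ?_
  simp_rw [detailed_balance_pow hrev r _ v]
  rw [← Finset.sum_mul, ← Finset.mul_sum, sum_pow_eq_one h1, mul_one]

end MarkovChain

/-- In a `K_{s,s}`-free graph, only few vertices are adjacent to a fixed proportion of a large
vertex set. -/
lemma KssFree.card_filter_le {V : Type*} [Fintype V] [DecidableEq V] {G : SimpleGraph V}
    [DecidableRel G.Adj] {s K : ℕ} (hG : KssFree G s) (hs : 1 ≤ s) (X : Finset V)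
    (hX : 2 * s * K ≤ X.card) :
    (Finset.univ.filter fun u => X.card < K * (X.filter (G.Adj u)).card).card ≤
      s * (2 * K) ^ s := by
  set B := Finset.univ.filter fun u => X.card < K * (X.filter (G.Adj u)).card with hB
  rcases B.eq_empty_or_nonempty with hBe | ⟨u₀, hu₀⟩
  · simp [hBe]
  have hK : 0 < K := by
    rcases Nat.eq_zero_or_pos K with rfl | h
    · simp [hB] at hu₀
    · exact h
  have hsX : s ≤ X.card := by nlinarith
  let r : V → Finset V → Prop := fun u T => T ⊆ X.filter (G.Adj u)
  have hchoose : ∀ u ∈ B, X.card.choose s ≤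
      (2 * K) ^ s * (Finset.bipartiteAbove r (X.powersetCard s) u).card := by
    intro u hu
    have hu' := (Finset.mem_filter.1 hu).2
    set m := (X.filter (G.Adj u)).card with hm
    have e : Finset.bipartiteAbove r (X.powersetCard s) u =
        (X.filter (G.Adj u)).powersetCard s := by
      ext T
      simp only [Finset.bipartiteAbove, Finset.mem_filter, Finset.mem_powersetCard, r]
      exact ⟨fun h => ⟨h.2, h.1.2⟩, fun h => ⟨⟨h.1.trans (Finset.filter_subset _ _), h.2⟩, h.1⟩⟩
    rw [e, Finset.card_powersetCard, ← hm]
    have hms : 2 * s < m := by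
      by_contra! h
      have := Nat.mul_le_mul_left K h
      nlinarith
    have h2 : X.card ≤ 2 * K * (m + 1 - s) := by
      obtain ⟨a, ha⟩ : ∃ a, m = 2 * s + a := ⟨m - 2 * s, by omega⟩
      rw [show m + 1 - s = s + a + 1 by omega]
      rw [ha] at hu'
      nlinarith
    have h3 : X.card.choose s * s.factorial ≤ (2 * K) ^ s * m.choose s * s.factorial := by
      calc X.card.choose s * s.factorial = X.card.descFactorial s := by
            rw [Nat.descFactorial_eq_factorial_mul_choose, mul_comm]
        _ ≤ X.card ^ s := Nat.descFactorial_le_pow _ _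
        _ ≤ (2 * K * (m + 1 - s)) ^ s := Nat.pow_le_pow_left h2 s
        _ = (2 * K) ^ s * (m + 1 - s) ^ s := mul_pow _ _ _
        _ ≤ (2 * K) ^ s * m.descFactorial s :=
            Nat.mul_le_mul_left _ (Nat.pow_sub_le_descFactorial _ _)
        _ = (2 * K) ^ s * m.choose s * s.factorial := by
            rw [Nat.descFactorial_eq_factorial_mul_choose]; ring
    exact Nat.le_of_mul_le_mul_right h3 (Nat.factorial_pos s)
  have hbelow : ∀ T ∈ X.powersetCard s, (Finset.bipartiteBelow r B T).card ≤ s := by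
    intro T hT
    by_contra! h
    obtain ⟨A, hA, hAs⟩ := Finset.exists_subset_card_eq h.le
    have hadj : ∀ a ∈ A, ∀ b ∈ T, G.Adj a b := fun a ha b hb =>
      (Finset.mem_filter.1 ((Finset.mem_filter.1 (hA ha)).2 hb)).2
    exact hG ⟨A, T, Finset.disjoint_left.2 fun v h1 h2 => G.irrefl (hadj v h1 v h2), hAs,
      (Finset.mem_powersetCard.1 hT).2, hadj⟩
  have hcount : B.card * X.card.choose s ≤ s * (2 * K) ^ s * X.card.choose s := by
    calc B.card * X.card.choose s = ∑ _u ∈ B, X.card.choose s := by simp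
      _ ≤ ∑ u ∈ B, (2 * K) ^ s * (Finset.bipartiteAbove r (X.powersetCard s) u).card :=
          Finset.sum_le_sum hchoose
      _ = (2 * K) ^ s * ∑ T ∈ X.powersetCard s, (Finset.bipartiteBelow r B T).card := by
          rw [← Finset.mul_sum, Finset.sum_card_bipartiteAbove_eq_sum_card_bipartiteBelow]
      _ ≤ (2 * K) ^ s * ∑ _T ∈ X.powersetCard s, s :=
          Nat.mul_le_mul_left _ (Finset.sum_le_sum hbelow)
      _ = s * (2 * K) ^ s * X.card.choose s := by
          rw [Finset.sum_const, Finset.card_powersetCard, smul_eq_mul]; ring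
  exact Nat.le_of_mul_le_mul_right hcount (Nat.choose_pos hsX)

section RandomWalk

variable {V : Type*} [Fintype V] (G : SimpleGraph V) [DecidableRel G.Adj]

/-- The transition matrix of the simple random walk on `G`. -/
noncomputable def rwMatrix : Matrix V V ℝ := fun x v => if G.Adj x v then (G.degree x : ℝ)⁻¹ else 0

variable {G}

lemma rwMatrix_nonneg (x v : V) : 0 ≤ rwMatrix G x v := by
  unfold rwMatrix; split_ifs <;> positivity

lemma sum_rwMatrix {x : V} (hx : 0 < G.degree x) : ∑ v, rwMatrix G x v = 1 := by
  have : (G.degree x : ℝ) ≠ 0 := by exact_mod_cast hx.ne'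
  simp only [rwMatrix, ← Finset.sum_filter, Finset.sum_const, nsmul_eq_mul,
    ← SimpleGraph.neighborFinset_eq_filter, SimpleGraph.card_neighborFinset_eq_degree]
  exact mul_inv_cancel₀ this

lemma rwMatrix_le {d : ℕ} (hd : 0 < d) (hdeg : ∀ x, d ≤ G.degree x) (x v : V) :
    rwMatrix G x v ≤ (d : ℝ)⁻¹ := by
  have hd' : (0 : ℝ) < d := by exact_mod_cast hd
  unfold rwMatrix
  split_ifs
  · exact inv_anti₀ hd' (by exact_mod_cast hdeg x)
  · positivity

lemma degree_mul_rwMatrix (hpos : ∀ x, 0 < G.degree x) (u v : V) :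
    (G.degree u : ℝ) * rwMatrix G u v = G.degree v * rwMatrix G v u := by
  have hu : (G.degree u : ℝ) ≠ 0 := by exact_mod_cast (hpos u).ne'
  have hv : (G.degree v : ℝ) ≠ 0 := by exact_mod_cast (hpos v).ne'
  unfold rwMatrix
  by_cases h : G.Adj u v
  · rw [if_pos h, if_pos h.symm, mul_inv_cancel₀ hu, mul_inv_cancel₀ hv]
  · rw [if_neg h, if_neg fun h' => h h'.symm, mul_zero, mul_zero]

variable [DecidableEq V]

/-- The indicator that `u` and `v` are equal or adjacent. -/
noncomputable def closeInd (G : SimpleGraph V) [DecidableRel G.Adj] (u v : V) : ℝ :=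
  if u = v ∨ G.Adj u v then 1 else 0

/-- One step of the walk from `x` lands on or next to `u` with small probability, unless `u` is
adjacent to a large proportion of the neighbours of `x`. -/
lemma rwMatrix_mulVec_closeInd_le {d K : ℕ} (hd : 0 < d) (hK : 0 < K)
    (hdeg : ∀ x, d ≤ G.degree x) (u x : V) :
    (rwMatrix G).mulVec (closeInd G u) x ≤ (d : ℝ)⁻¹ + (K : ℝ)⁻¹ +
      if G.degree x < K * ((G.neighborFinset x).filter (G.Adj u)).card then 1 else 0 := by
  have hx : (0 : ℝ) < G.degree x := by exact_mod_cast hd.trans_le (hdeg x)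
  have hK' : (0 : ℝ) < K := by exact_mod_cast hK
  have h1 : (rwMatrix G).mulVec (closeInd G u) x ≤
      rwMatrix G x u + ∑ v, rwMatrix G x v * if G.Adj u v then 1 else 0 := by
    have e : rwMatrix G x u = ∑ v, rwMatrix G x v * if u = v then 1 else 0 := by simp
    rw [e, ← Finset.sum_add_distrib]
    refine Finset.sum_le_sum fun v _ => ?_
    rw [← mul_add]
    refine mul_le_mul_of_nonneg_left ?_ (rwMatrix_nonneg x v)
    unfold closeInd
    split_ifs <;> simp_all
  have h2 : ∑ v, (rwMatrix G x v * if G.Adj u v then 1 else 0) =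
      ((G.neighborFinset x).filter (G.Adj u)).card * (G.degree x : ℝ)⁻¹ := by
    rw [SimpleGraph.neighborFinset_eq_filter, Finset.filter_filter, ← nsmul_eq_mul,
      ← Finset.sum_const, Finset.sum_filter]
    refine Finset.sum_congr rfl fun v _ => ?_
    unfold rwMatrix
    split_ifs <;> simp_all
  have h3 : ((G.neighborFinset x).filter (G.Adj u)).card * (G.degree x : ℝ)⁻¹ ≤
      (K : ℝ)⁻¹ + if G.degree x < K * ((G.neighborFinset x).filter (G.Adj u)).card
        then 1 else 0 := by
    split_ifs with h
    · have : (((G.neighborFinset x).filter (G.Adj u)).card : ℝ) ≤ G.degree x := by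
        rw [← SimpleGraph.card_neighborFinset_eq_degree]
        exact_mod_cast Finset.card_filter_le _ _
      have h4 : ((G.neighborFinset x).filter (G.Adj u)).card * (G.degree x : ℝ)⁻¹ ≤ 1 := by
        rw [← div_eq_mul_inv]; exact div_le_one_of_le₀ this hx.le
      have : (0 : ℝ) ≤ (K : ℝ)⁻¹ := by positivity
      linarith
    · rw [add_zero, ← div_eq_mul_inv, div_le_iff₀ hx, inv_mul_eq_div, le_div_iff₀ hK']
      have : ((G.neighborFinset x).filter (G.Adj u)).card * K ≤ G.degree x := by
        rw [mul_comm]; exact not_lt.1 h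
      exact_mod_cast this
  have := rwMatrix_le hd hdeg x u
  linarith

/-- In the stationary walk, the positions at two times differing by at least two are equal or
adjacent only with small probability. -/
lemma sum_degree_mul_closeInd_le {d K b : ℕ} (hd : 0 < d) (hK : 0 < K)
    (hdeg : ∀ x, d ≤ G.degree x)
    (hb : ∀ x, (Finset.univ.filter fun u =>
      G.degree x < K * ((G.neighborFinset x).filter (G.Adj u)).card).card ≤ b) (r : ℕ) :
    ∑ u, (G.degree u : ℝ) * (rwMatrix G ^ (r + 2)).mulVec (closeInd G u) u ≤
      ((d : ℝ)⁻¹ + (K : ℝ)⁻¹ + b * (d : ℝ)⁻¹) * ∑ u, (G.degree u : ℝ) := by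
  set P := rwMatrix G with hP
  have hpos : ∀ x, 0 < G.degree x := fun x => hd.trans_le (hdeg x)
  have h0 : ∀ x v, 0 ≤ P x v := rwMatrix_nonneg
  have h1 : ∀ x, ∑ v, P x v = 1 := fun x => sum_rwMatrix (hpos x)
  let I : V → V → ℝ := fun u x =>
    if G.degree x < K * ((G.neighborFinset x).filter (G.Adj u)).card then 1 else 0
  have step : ∀ u, (P ^ (r + 2)).mulVec (closeInd G u) u ≤
      (d : ℝ)⁻¹ + (K : ℝ)⁻¹ + ∑ x, (P ^ (r + 1)) u x * I u x := by
    intro u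
    rw [pow_succ, ← Matrix.mulVec_mulVec]
    calc ∑ x, (P ^ (r + 1)) u x * P.mulVec (closeInd G u) x
        ≤ ∑ x, (P ^ (r + 1)) u x * ((d : ℝ)⁻¹ + (K : ℝ)⁻¹ + I u x) :=
          Finset.sum_le_sum fun x _ => mul_le_mul_of_nonneg_left
            (rwMatrix_mulVec_closeInd_le hd hK hdeg u x) (pow_nonneg_of_nonneg h0 _ u x)
      _ = _ := by
          simp_rw [mul_add _ ((d : ℝ)⁻¹ + (K : ℝ)⁻¹), Finset.sum_add_distrib, ← Finset.sum_mul]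
          rw [sum_pow_eq_one h1, one_mul]
  have hI : ∀ x, ∑ u, (P ^ (r + 1)) x u * I u x ≤ b * (d : ℝ)⁻¹ := by
    intro x
    calc ∑ u, (P ^ (r + 1)) x u * I u x ≤ ∑ u, (d : ℝ)⁻¹ * I u x :=
          Finset.sum_le_sum fun u _ => mul_le_mul_of_nonneg_right
            (pow_succ_apply_le h0 h1 (rwMatrix_le hd hdeg) r x u)
            (by simp only [I]; split_ifs <;> norm_num)
      _ = (Finset.univ.filter fun u => G.degree x <
            K * ((G.neighborFinset x).filter (G.Adj u)).card).card * (d : ℝ)⁻¹ := by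
          rw [← Finset.mul_sum, mul_comm, Finset.sum_boole]
      _ ≤ b * (d : ℝ)⁻¹ :=
          mul_le_mul_of_nonneg_right (by exact_mod_cast hb x) (by positivity)
  have hbal := detailed_balance_pow (P := P) (π := fun x => (G.degree x : ℝ))
    (degree_mul_rwMatrix hpos) (r + 1)
  calc ∑ u, (G.degree u : ℝ) * (P ^ (r + 2)).mulVec (closeInd G u) u
      ≤ ∑ u, (G.degree u : ℝ) * ((d : ℝ)⁻¹ + (K : ℝ)⁻¹ + ∑ x, (P ^ (r + 1)) u x * I u x) :=
        Finset.sum_le_sum fun u _ => mul_le_mul_of_nonneg_left (step u) (by positivity)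
    _ = ((d : ℝ)⁻¹ + (K : ℝ)⁻¹) * ∑ u, (G.degree u : ℝ) +
        ∑ x, (G.degree x : ℝ) * ∑ u, (P ^ (r + 1)) x u * I u x := by
        simp_rw [mul_add _ ((d : ℝ)⁻¹ + (K : ℝ)⁻¹), Finset.sum_add_distrib, ← Finset.sum_mul]
        rw [mul_comm]
        simp_rw [add_right_inj, Finset.mul_sum, ← mul_assoc]
        rw [Finset.sum_comm]
        simp_rw [hbal]
    _ ≤ ((d : ℝ)⁻¹ + (K : ℝ)⁻¹) * ∑ u, (G.degree u : ℝ) +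
        ∑ x, (G.degree x : ℝ) * (b * (d : ℝ)⁻¹) :=
        add_le_add_right (Finset.sum_le_sum fun x _ =>
          mul_le_mul_of_nonneg_left (hI x) (by positivity)) _
    _ = _ := by rw [← Finset.sum_mul]; ring

/-- If the random walk is unlikely to come back close to an earlier position, then the graph
contains a long induced path. -/
lemma hasInducedPathOn_of_minDegree_of_card_le [Nonempty V] {d K b k : ℕ} (hd : 0 < d) (hK : 0 < K)
    (hdeg : ∀ x, d ≤ G.degree x)
    (hb : ∀ x, (Finset.univ.filter fun u =>
      G.degree x < K * ((G.neighborFinset x).filter (G.Adj u)).card).card ≤ b)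
    (hk : (k : ℝ) ^ 2 * ((d : ℝ)⁻¹ + (K : ℝ)⁻¹ + b * (d : ℝ)⁻¹) < 1) : HasInducedPathOn G k := by
  set P := rwMatrix G with hP
  have hpos : ∀ x, 0 < G.degree x := fun x => hd.trans_le (hdeg x)
  have h0 : ∀ x v, 0 ≤ P x v := rwMatrix_nonneg
  have h1 : ∀ x, ∑ v, P x v = 1 := fun x => sum_rwMatrix (hpos x)
  set δ : ℝ := (d : ℝ)⁻¹ + (K : ℝ)⁻¹ + b * (d : ℝ)⁻¹ with hδ
  have hδ0 : 0 ≤ δ := by positivity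
  set S := (Finset.range k ×ˢ Finset.range k).filter fun p => p.1 + 2 ≤ p.2 with hS
  have hScard : (S.card : ℝ) ≤ (k : ℝ) ^ 2 := by
    have : S.card ≤ k * k := (Finset.card_filter_le _ _).trans (by simp)
    rw [sq]; exact_mod_cast this
  let F : (ℕ → V) → ℝ := fun y => ∑ p ∈ S, closeInd G (y p.1) (y p.2)
  have hdegsum : 0 < ∑ u, (G.degree u : ℝ) :=
    Finset.sum_pos (fun u _ => by exact_mod_cast hpos u) Finset.univ_nonempty
  have hpair : ∀ p ∈ S, ∑ x, (G.degree x : ℝ) *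
      walkExp P k (fun y => closeInd G (y p.1) (y p.2)) x ≤ δ * ∑ u, (G.degree u : ℝ) := by
    rintro ⟨i, j⟩ hp
    obtain ⟨hp, hij⟩ := Finset.mem_filter.1 hp
    have hj : j < k := Finset.mem_range.1 (Finset.mem_product.1 hp).2
    obtain ⟨r, rfl⟩ : ∃ r, j = i + (r + 2) := ⟨j - i - 2, by simp only at hij; omega⟩
    simp only [walkExp_apply_apply h1 k i (r + 2) hj.le]
    rw [sum_mul_mulVec_pow h1 (degree_mul_rwMatrix hpos)]
    exact sum_degree_mul_closeInd_le hd hK hdeg hb r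
  obtain ⟨x, hx⟩ : ∃ x, walkExp P k F x < 1 := by
    by_contra! h
    have h2 : ∑ u, (G.degree u : ℝ) ≤ ∑ x, (G.degree x : ℝ) * walkExp P k F x :=
      Finset.sum_le_sum fun x _ => le_mul_of_one_le_right (by positivity) (h x)
    have h3 : ∑ x, (G.degree x : ℝ) * walkExp P k F x ≤ S.card * (δ * ∑ u, (G.degree u : ℝ)) := by
      have e : ∑ x, (G.degree x : ℝ) * walkExp P k F x = ∑ p ∈ S, ∑ x, (G.degree x : ℝ) *
          walkExp P k (fun y => closeInd G (y p.1) (y p.2)) x := by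
        simp only [F, walkExp_sum, Finset.mul_sum]
        exact Finset.sum_comm
      rw [e, ← nsmul_eq_mul, ← Finset.sum_const]
      exact Finset.sum_le_sum hpair
    have h4 : (S.card : ℝ) * (δ * ∑ u, (G.degree u : ℝ)) < ∑ u, (G.degree u : ℝ) := by
      rw [← mul_assoc]
      refine mul_lt_of_lt_one_left hdegsum (lt_of_le_of_lt ?_ hk)
      exact mul_le_mul_of_nonneg_right hScard hδ0
    linarith
  obtain ⟨y, -, hyP, hyF⟩ := exists_walk_le_walkExp h0 h1 k F x
  have hadj : ∀ i < k, G.Adj (y i) (y (i + 1)) := fun i hi => by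
    by_contra h
    have := hyP i hi
    simp [hP, rwMatrix, h] at this
  have hfar : ∀ i j, i + 2 ≤ j → j < k → y i ≠ y j ∧ ¬ G.Adj (y i) (y j) := by
    intro i j hij hj
    by_contra h
    have h' : y i = y j ∨ G.Adj (y i) (y j) := by tauto
    have hmem : (i, j) ∈ S := Finset.mem_filter.2 ⟨Finset.mem_product.2
      ⟨Finset.mem_range.2 (by omega), Finset.mem_range.2 hj⟩, hij⟩
    have := Finset.single_le_sum (f := fun p : ℕ × ℕ => closeInd G (y p.1) (y p.2))
      (fun p _ => by unfold closeInd; split_ifs <;> norm_num) hmem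
    simp only [closeInd, if_pos h'] at this
    exact absurd (hyF.trans_lt hx) (not_lt.2 this)
  have hne : ∀ i j, i < j → j < k → y i ≠ y j := by
    intro i j hij hj
    rcases Nat.lt_or_ge j (i + 2) with h | h
    · obtain rfl : j = i + 1 := by omega
      exact (hadj i (by omega)).ne
    · exact (hfar i j h hj).1
  refine ⟨fun i => y i, fun i j hij => ?_, fun i j hij => ⟨fun h => ?_, fun h => ?_⟩⟩
  · rcases lt_trichotomy (i : ℕ) j with h | h | h
    · exact absurd hij (hne i j h j.2)
    · exact Fin.ext h
    · exact absurd hij.symm (hne j i h i.2)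
  · by_contra hne'
    have : (i : ℕ) < j := hij
    exact (hfar i j (by omega) j.2).2 h
  · simp only [h]; exact hadj i i.2

/-- A `K_{s,s}`-free graph with minimum degree polynomially large in `k` contains an induced path
on `k` vertices. -/
lemma KssFree.hasInducedPathOn_of_minDegree [Nonempty V] {s k : ℕ} (hG : KssFree G s) (hs : 1 ≤ s)
    (hk : 1 ≤ k) (hdeg : ∀ x, 2 * s * (4 * k ^ 2) ^ (s + 1) ≤ G.degree x) :
    HasInducedPathOn G k := by
  have hk4 : 1 ≤ 4 * k ^ 2 := by nlinarith
  set b := s * (4 * k ^ 2) ^ s with hb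
  have hb1 : 1 ≤ b := Nat.mul_pos hs (by positivity)
  have hd : 2 * s * (4 * k ^ 2) ^ (s + 1) = 8 * k ^ 2 * b := by rw [hb, pow_succ]; ring
  rw [hd] at hdeg
  have hsb : s ≤ b := Nat.le_mul_of_pos_right _ (by positivity)
  refine hasInducedPathOn_of_minDegree_of_card_le (d := 8 * k ^ 2 * b) (K := 2 * k ^ 2) (b := b)
    (by positivity) (by positivity) hdeg (fun x => ?_) ?_
  · have := hG.card_filter_le hs (K := 2 * k ^ 2) (G.neighborFinset x) (by
      rw [SimpleGraph.card_neighborFinset_eq_degree]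
      refine le_trans ?_ (hdeg x)
      nlinarith [Nat.mul_le_mul_left (k ^ 2) hsb])
    rw [SimpleGraph.card_neighborFinset_eq_degree] at this
    rwa [hb, show 4 * k ^ 2 = 2 * (2 * k ^ 2) by ring]
  · have hk' : (1 : ℝ) ≤ k := by exact_mod_cast hk
    have hb' : (1 : ℝ) ≤ b := by exact_mod_cast hb1
    push_cast
    have e : (k : ℝ) ^ 2 * ((8 * (k : ℝ) ^ 2 * b)⁻¹ + (2 * (k : ℝ) ^ 2)⁻¹ +
        b * (8 * (k : ℝ) ^ 2 * b)⁻¹) = (b : ℝ)⁻¹ / 8 + 5 / 8 := by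
      field_simp
      ring
    rw [e]
    have := inv_le_one_of_one_le₀ hb'
    linarith

end RandomWalk

/-- A degenerate graph has an orientation with small out-degrees. -/
lemma exists_orientation {V : Type*} [Fintype V] {G : SimpleGraph V} [DecidableRel G.Adj] {d : ℕ}
    (h : ∀ S : Finset V, S.Nonempty → ∃ v ∈ S, (S.filter (G.Adj v)).card ≤ d) :
    ∃ N : V → Finset V, (∀ v, (N v).card ≤ d) ∧ (∀ v, ∀ u ∈ N v, G.Adj v u) ∧
      ∀ u v, G.Adj u v → u ∈ N v ∨ v ∈ N u := by
  classical
  suffices H : ∀ S : Finset V, ∃ N : V → Finset V, (∀ v, (N v).card ≤ d) ∧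
      (∀ v, ∀ u ∈ N v, G.Adj v u) ∧ ∀ u ∈ S, ∀ v ∈ S, G.Adj u v → u ∈ N v ∨ v ∈ N u by
    obtain ⟨N, h1, h2, h3⟩ := H Finset.univ
    exact ⟨N, h1, h2, fun u v => h3 u (Finset.mem_univ u) v (Finset.mem_univ v)⟩
  intro S
  induction S using Finset.strongInduction with
  | H S ih =>
    rcases S.eq_empty_or_nonempty with rfl | hS
    · exact ⟨fun _ => ∅, by simp, by simp, by simp⟩
    obtain ⟨w, hw, hwd⟩ := h S hS
    obtain ⟨N, h1, h2, h3⟩ := ih _ (Finset.erase_ssubset hw)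
    refine ⟨Function.update N w (S.filter (G.Adj w)), fun v => ?_, fun v u hu => ?_,
      fun u hu v hv huv => ?_⟩
    · rcases eq_or_ne v w with rfl | hv
      · simpa using hwd
      · simpa [hv] using h1 v
    · rcases eq_or_ne v w with rfl | hv
      · simp at hu; exact hu.2
      · simp [hv] at hu; exact h2 v u hu
    · rcases eq_or_ne v w with rfl | hvw
      · left; simp [hu, huv.symm]
      rcases eq_or_ne u w with rfl | huw
      · right; simp [hv, huv]
      simpa [hvw, huw] using h3 u (Finset.mem_erase.2 ⟨huw, hu⟩) v (Finset.mem_erase.2 ⟨hvw, hv⟩) huv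

lemma KssFree.induce {V : Type*} {G : SimpleGraph V} {s : ℕ} (hG : KssFree G s) (S : Set V) :
    KssFree (G.induce S) s := by
  rintro ⟨A, B, hAB, hA, hB, h⟩
  refine hG ⟨A.map (.subtype _), B.map (.subtype _), (Finset.disjoint_map _).2 hAB, by simpa,
    by simpa, ?_⟩
  rintro a ha b hb
  obtain ⟨a, ha', rfl⟩ := Finset.mem_map.1 ha
  obtain ⟨b, hb', rfl⟩ := Finset.mem_map.1 hb
  exact h a ha' b hb'

lemma HasInducedPathOn.of_induce {V : Type*} {G : SimpleGraph V} {S : Set V} {k : ℕ}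
    (h : HasInducedPathOn (G.induce S) k) : HasInducedPathOn G k := by
  obtain ⟨f, hf, hadj⟩ := h
  exact ⟨fun i => f i, Subtype.val_injective.comp hf, hadj⟩

lemma KssFree.hasInducedPathOn_of_hasPathOn {V : Type*} [Fintype V] {G : SimpleGraph V}
    {s k d n : ℕ} (hG : KssFree G s) (hs : 1 ≤ s) (hk : 1 ≤ k)
    (hd : d = 2 * s * (4 * k ^ 2) ^ (s + 1)) (hn : (d + 2) ^ (d + 2) ^ k ≤ n)
    (hpath : HasPathOn G n) : HasInducedPathOn G k := by
  classical
  by_contra hno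
  refine hno ?_
  obtain ⟨N, h1, h2, h3⟩ := exists_orientation (G := G) (d := d) fun S hS => by
    by_contra! h
    have : Nonempty (S : Set V) := hS.to_subtype
    refine hno (HasInducedPathOn.of_induce (S := (S : Set V))
      ((hG.induce (S : Set V)).hasInducedPathOn_of_minDegree hs hk fun x => ?_))
    rw [← hd]
    refine (h x x.2).le.trans ?_
    rw [← SimpleGraph.card_neighborFinset_eq_degree,
      ← Finset.card_map (Function.Embedding.subtype _)]
    refine Finset.card_le_card fun v hv => ?_
    obtain ⟨hvS, hv⟩ := Finset.mem_filter.1 hv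
    exact Finset.mem_map.2 ⟨⟨v, hvS⟩, by simpa using hv, rfl⟩
  exact hasInducedPathOn_of_orientation h1 h2 h3 hn hpath

lemma tower_bound {s k : ℕ} (hs : 1 ≤ s) (hk : 2 ≤ k) :
    (2 * s * (4 * k ^ 2) ^ (s + 1) + 2) ^ (2 * s * (4 * k ^ 2) ^ (s + 1) + 2) ^ k ≤
      k ^ ((5 * s + 6) * k ^ ((5 * s + 6) * k)) := by
  have h1 : 2 * s * (4 * k ^ 2) ^ (s + 1) + 2 ≤ k ^ (5 * s + 6) := by
    have h4 : 4 ≤ k ^ 2 := by nlinarith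
    have hsk : s ≤ k ^ s := (Nat.lt_two_pow_self).le.trans (Nat.pow_le_pow_left hk s)
    have hpos : 1 ≤ s * (4 * k ^ 2) ^ (s + 1) := Nat.mul_pos hs (by positivity)
    calc 2 * s * (4 * k ^ 2) ^ (s + 1) + 2 ≤ 4 * (s * (4 * k ^ 2) ^ (s + 1)) := by
          rw [mul_assoc]; omega
      _ ≤ k ^ 2 * (k ^ s * (k ^ 2 * k ^ 2) ^ (s + 1)) := by gcongr
      _ = k ^ (5 * s + 6) := by rw [← pow_add, ← pow_mul, ← pow_add, ← pow_add]; ring_nf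
  calc _ ≤ (k ^ (5 * s + 6)) ^ (2 * s * (4 * k ^ 2) ^ (s + 1) + 2) ^ k := Nat.pow_le_pow_left h1 _
    _ ≤ (k ^ (5 * s + 6)) ^ (k ^ (5 * s + 6)) ^ k :=
        Nat.pow_le_pow_right (by positivity) (Nat.pow_le_pow_left h1 _)
    _ = _ := by rw [← pow_mul, ← pow_mul]

lemma pow_tower_le {a k n : ℕ} (hk : 2 ≤ k) (ha : 1 ≤ a) (hn : 3 ≤ n)
    (h : 3 * a * (k * Real.log k) ≤ Real.log (Real.log n)) : k ^ (a * k ^ (a * k)) ≤ n := by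
  have hk0 : (0 : ℝ) < k := by positivity
  have hn0 : (0 : ℝ) < n := by positivity
  have hlogn : 0 < Real.log n := Real.log_pos (by exact_mod_cast (by omega : 1 < n))
  have h1 : ((k ^ (3 * a * k) : ℕ) : ℝ) ≤ Real.log n := by
    rw [← Real.log_le_log_iff (by positivity) hlogn]
    push_cast
    rw [Real.log_pow]
    push_cast
    linarith
  have h2 : a * k ^ (a * k) * k ≤ k ^ (3 * a * k) := by
    have hak : a ≤ k ^ a := (Nat.lt_two_pow_self).le.trans (Nat.pow_le_pow_left hk a)
    calc a * k ^ (a * k) * k ≤ k ^ a * k ^ (a * k) * k := by gcongr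
      _ = k ^ (a + a * k + 1) := by ring
      _ ≤ k ^ (3 * a * k) := Nat.pow_le_pow_right (by omega) (by nlinarith)
  have h3 : Real.log ((k ^ (a * k ^ (a * k)) : ℕ) : ℝ) ≤ Real.log n := by
    refine le_trans ?_ ((Nat.cast_le.2 h2).trans h1)
    push_cast
    rw [Real.log_pow]
    push_cast
    gcongr
    exact Real.log_le_self hk0.le
  exact_mod_cast (Real.log_le_log_iff (by positivity) hn0).1 h3

/-- For every integer `s ≥ 2` there exist a constant `c > 0` and a threshold `n₀`
(depending only on `s`) such that for every `n ≥ n₀`, every `K_{s,s}`-free finite simple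
graph containing a path on `n` vertices contains an induced path on at least
`c · (log log n) / (log log log n)` vertices. -/
theorem galvin_rival_sands_lower_bound :
    ∀ s : ℕ, 2 ≤ s →
      ∃ c : ℝ, 0 < c ∧ ∃ n₀ : ℕ, ∀ n : ℕ, n₀ ≤ n →
        ∀ (V : Type) [Fintype V] (G : SimpleGraph V),
          KssFree G s → HasPathOn G n →
            ∃ k : ℕ, HasInducedPathOn G k ∧
              c * (Real.log (Real.log n) / Real.log (Real.log (Real.log n))) ≤ (k : ℝ) := by
  intro s hs
  set a := 5 * s + 6 with ha
  set A : ℝ := 3 * a with hA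
  have hApos : 1 ≤ A := by rw [hA, ha]; push_cast; linarith [(Nat.cast_nonneg s : (0 : ℝ) ≤ s)]
  have hloglog : Filter.Tendsto (fun n : ℕ => Real.log (Real.log n)) Filter.atTop Filter.atTop :=
    Real.tendsto_log_atTop.comp (Real.tendsto_log_atTop.comp tendsto_natCast_atTop_atTop)
  have hlarge : ∀ᶠ x : ℝ in Filter.atTop, 1 ≤ Real.log x ∧ 2 * A * Real.log x ≤ x := by
    filter_upwards [Real.tendsto_log_atTop.eventually_ge_atTop 1, Filter.eventually_gt_atTop 0,
      Real.isLittleO_log_id_atTop.def (show 0 < (2 * A)⁻¹ by positivity)] with x h1 h0 h2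
    refine ⟨h1, ?_⟩
    rw [id, Real.norm_of_nonneg (by linarith), Real.norm_of_nonneg h0.le,
      inv_mul_eq_div, le_div_iff₀ (by positivity)] at h2
    linarith
  obtain ⟨n₀, hn₀⟩ := Filter.eventually_atTop.1
    ((hloglog.eventually hlarge).and (Filter.eventually_ge_atTop 3))
  refine ⟨(2 * A)⁻¹, by positivity, n₀, fun n hn V _ G hG hpath => ?_⟩
  obtain ⟨⟨hL, hx⟩, hn3⟩ := hn₀ n hn
  set x := Real.log (Real.log n) with hxdef
  set L := Real.log x with hLdef
  have hx0 : 0 < x := by nlinarith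
  have hz : 2 ≤ x / (A * L) := by rw [le_div_iff₀ (by positivity)]; linarith
  set k := ⌊x / (A * L)⌋₊ with hk
  have hk2 : 2 ≤ k := Nat.le_floor (by exact_mod_cast hz)
  have hkle : (k : ℝ) ≤ x / (A * L) := Nat.floor_le (by positivity)
  have hkx : (k : ℝ) ≤ x := hkle.trans (div_le_self hx0.le (by nlinarith))
  have hlogk : Real.log k ≤ L := Real.log_le_log (by positivity) hkx
  refine ⟨k, hG.hasInducedPathOn_of_hasPathOn (by omega) (by omega) rfl
    ((tower_bound (by omega) hk2).trans (pow_tower_le hk2 (by omega) hn3 ?_)) hpath, ?_⟩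
  · rw [← ha, ← hA]
    calc A * (k * Real.log k) ≤ A * (x / (A * L) * L) := by gcongr
      _ = x := by field_simp
  · have h1 := Nat.lt_floor_add_one (x / (A * L))
    rw [← hk] at h1
    have h2 : (2 * A)⁻¹ * (x / L) = x / (A * L) / 2 := by field_simp
    rw [h2]
    linarith
end

section
/- Let d, s ≥ 2 be integers and let t ≥ 1 be a real number with t ≤ d^{1/s}/s. Let G be a K_{s,s}-free simple graph in which every vertex has degree at least d, and let v be a vertex of G. Then the number of vertices u ∈ V(G) satisfying |N(u) ∩ N(v)| ≥ (4/t)·|N(v)| is strictly less than s·t. -/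
open Finset in
/-- In a `K_{s,s}`-free graph every `s`-set has at most `s - 1` common neighbours. Double counting
gives a bound on the number of `s`-stars with centre in `W` and leaves in `U`. -/
theorem KssFree.sum_choose_le {V : Type*} [Fintype V] [DecidableEq V] {G : SimpleGraph V}
    [DecidableRel G.Adj] {s : ℕ} (hG : KssFree G s) (U W : Finset V) :
    ∑ w ∈ W, (#(U ∩ G.neighborFinset w)).choose s ≤ (s - 1) * (#U).choose s := by
  have hstar : ∀ w ∈ W, (#(U ∩ G.neighborFinset w)).choose s =
      #(bipartiteAbove (fun w S => S ⊆ G.neighborFinset w) (powersetCard s U) w) := by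
    intro w _
    rw [← card_powersetCard]
    congr 1
    ext S
    simp only [mem_powersetCard, mem_bipartiteAbove, subset_inter_iff]
    tauto
  rw [sum_congr rfl hstar, sum_card_bipartiteAbove_eq_sum_card_bipartiteBelow, mul_comm,
    ← card_powersetCard s U, ← smul_eq_mul]
  refine sum_le_card_nsmul _ _ _ fun S hS => ?_
  by_contra! hlt
  obtain ⟨B, hB, hBs⟩ := exists_subset_card_eq (Nat.le_of_pred_lt hlt)
  have hadj : ∀ a ∈ S, ∀ b ∈ B, G.Adj a b := fun a ha b hb => by
    have hsub := (mem_bipartiteBelow _).1 (hB hb) |>.2 ha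
    exact ((G.mem_neighborFinset _ _).1 hsub).symm
  refine hG ⟨S, B, ?_, (mem_powersetCard.1 hS).2, hBs, hadj⟩
  exact disjoint_left.2 fun a ha hb => G.irrefl (hadj a ha a hb)

open Finset in
/-- A power mean bound on the number of `s`-stars with centre in `W` and leaves in `U`. -/
theorem KssFree.pow_sum_tsub_le {V : Type*} [Fintype V] [DecidableEq V] {G : SimpleGraph V}
    [DecidableRel G.Adj] {s : ℕ} (hG : KssFree G s) (hs : s ≠ 0) (U W : Finset V) :
    (∑ w ∈ W, (#(U ∩ G.neighborFinset w) - s)) ^ s ≤ #W ^ (s - 1) * ((s - 1) * #U ^ s) := by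
  obtain ⟨k, rfl⟩ := Nat.exists_eq_succ_of_ne_zero hs
  refine (pow_sum_le_card_mul_sum_pow (fun _ _ => Nat.zero_le _) k).trans
    (Nat.mul_le_mul_left _ ?_)
  calc ∑ w ∈ W, (#(U ∩ G.neighborFinset w) - (k + 1)) ^ (k + 1)
      ≤ ∑ w ∈ W, (k + 1).factorial * (#(U ∩ G.neighborFinset w)).choose (k + 1) := by
        refine sum_le_sum fun w _ => ?_
        rw [← Nat.descFactorial_eq_factorial_mul_choose]
        exact (Nat.pow_le_pow_left (by omega) _).trans (Nat.pow_sub_le_descFactorial _ _)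
    _ ≤ (k + 1).factorial * (k * (#U).choose (k + 1)) := by
        rw [← mul_sum]
        exact Nat.mul_le_mul_left _ (hG.sum_choose_le U W)
    _ = k * (#U).descFactorial (k + 1) := by
        rw [Nat.descFactorial_eq_factorial_mul_choose]; ring
    _ ≤ k * #U ^ (k + 1) := Nat.mul_le_mul_left _ (Nat.descFactorial_le_pow _ _)

/-- Let `d, s ≥ 2` be integers and `t ≥ 1` a real number with `t ≤ d^{1/s}/s`. If `G` is a
`K_{s,s}`-free finite simple graph of minimum degree at least `d` and `v` is a vertex of `G`,
then strictly fewer than `s·t` vertices `u` satisfy `|N(u) ∩ N(v)| ≥ (4/t)·|N(v)|`. -/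
theorem sparse_codegree {d s : ℕ} (hd : 2 ≤ d) (hs : 2 ≤ s) {t : ℝ} (ht1 : 1 ≤ t)
    (ht : t ≤ (d : ℝ) ^ ((1 : ℝ) / (s : ℝ)) / (s : ℝ))
    {V : Type*} [Fintype V] [DecidableEq V] (G : SimpleGraph V) [DecidableRel G.Adj]
    (hKss : KssFree G s) (hdeg : ∀ w : V, d ≤ G.degree w) (v : V) :
    ((Finset.univ.filter fun u : V =>
        (4 / t) * ((G.neighborFinset v).card : ℝ) ≤
          ((G.neighborFinset u ∩ G.neighborFinset v).card : ℝ)).card : ℝ)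
      < (s : ℝ) * t := by
  by_contra! hlarge
  set U := Finset.univ.filter fun u : V =>
    (4 / t) * ((G.neighborFinset v).card : ℝ) ≤
      ((G.neighborFinset u ∩ G.neighborFinset v).card : ℝ)
  set N := G.neighborFinset v
  have ht0 : 0 < t := by linarith
  have hs0 : (0 : ℝ) < s := by positivity
  have hm0 : (0 : ℝ) < U.card := lt_of_lt_of_le (by positivity) hlarge
  have hdn : (d : ℝ) ≤ N.card := by exact_mod_cast hdeg v
  have hn0 : (0 : ℝ) < N.card := lt_of_lt_of_le (by positivity) hdn
  have hdpow : ((s : ℝ) * t) ^ s ≤ d := by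
    have hle : (s : ℝ) * t ≤ (d : ℝ) ^ ((1 : ℝ) / (s : ℝ)) := by
      rwa [le_div_iff₀ hs0, mul_comm] at ht
    calc ((s : ℝ) * t) ^ s ≤ ((d : ℝ) ^ ((1 : ℝ) / (s : ℝ))) ^ s := by gcongr
      _ = d := by rw [one_div, Real.rpow_inv_natCast_pow (by positivity) (by omega)]
  have hcount : ∑ w ∈ N, (U ∩ G.neighborFinset w).card =
      ∑ u ∈ U, (G.neighborFinset u ∩ N).card := by
    have := Finset.sum_card_bipartiteAbove_eq_sum_card_bipartiteBelow (s := N) (t := U) G.Adj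
    convert this using 3 <;> ext x <;>
      simp [Finset.mem_bipartiteAbove, Finset.mem_bipartiteBelow, G.adj_comm, and_comm]
  have hedges : (U.card : ℝ) * (4 / t * N.card) ≤
      ∑ w ∈ N, ((U ∩ G.neighborFinset w).card : ℝ) := by
    rw [← nsmul_eq_mul, ← Nat.cast_sum, hcount, Nat.cast_sum]
    exact Finset.card_nsmul_le_sum _ _ _ fun u hu => (Finset.mem_filter.1 hu).2
  have hexcess : 3 * U.card * N.card / t ≤
      ((∑ w ∈ N, ((U ∩ G.neighborFinset w).card - s) : ℕ) : ℝ) := by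
    have hsub : ∑ w ∈ N, (((U ∩ G.neighborFinset w).card : ℝ) - s) ≤
        ((∑ w ∈ N, ((U ∩ G.neighborFinset w).card - s) : ℕ) : ℝ) := by
      rw [Nat.cast_sum]
      exact Finset.sum_le_sum fun w _ => by
        rw [sub_le_iff_le_add]
        exact_mod_cast le_tsub_add
    rw [Finset.sum_sub_distrib, Finset.sum_const, nsmul_eq_mul] at hsub
    have hsm : (N.card : ℝ) * s ≤ N.card * (U.card / t) := by
      gcongr
      rwa [le_div_iff₀ ht0]
    have hsplit : 3 * U.card * N.card / t =
        (U.card : ℝ) * (4 / t * N.card) - N.card * (U.card / t) := by ring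
    linarith
  have hpow : ((∑ w ∈ N, ((U ∩ G.neighborFinset w).card - s) : ℕ) : ℝ) ^ s ≤
      N.card ^ (s - 1) * (s * U.card ^ s) := by
    have hnat := (hKss.pow_sum_tsub_le (by omega) U N).trans
      (Nat.mul_le_mul_left _ (Nat.mul_le_mul_right _ (Nat.sub_le s 1)))
    exact_mod_cast hnat
  have hbound := (pow_le_pow_left₀ (by positivity) hexcess s).trans hpow
  have hcancel : 3 ^ s * (N.card : ℝ) ≤ s * t ^ s := by
    have hN_pow : (N.card : ℝ) ^ s = N.card ^ (s - 1) * N.card := by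
      rw [← pow_succ, Nat.sub_add_cancel (by omega)]
    rw [div_pow, mul_pow, mul_pow, div_le_iff₀ (by positivity), hN_pow] at hbound
    refine le_of_mul_le_mul_left ?_ (by positivity : (0 : ℝ) < N.card ^ (s - 1) * U.card ^ s)
    linarith
  have hs_pow : (s : ℝ) ≤ s ^ s := by
    exact_mod_cast Nat.le_self_pow (by omega) s
  have hthree : (1 : ℝ) < 3 ^ s := one_lt_pow₀ (by norm_num) (by omega)
  have hst : (s : ℝ) * t ^ s ≤ N.card := by
    refine le_trans ?_ (hdpow.trans hdn)
    rw [mul_pow]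
    gcongr
  nlinarith
end

section
/- There exist a constant c > 0 and a threshold n₀ such that the following holds for every integer d ≥ 2 and every integer n ≥ n₀: if G is a d-degenerate simple graph on n vertices that contains a Hamilton path, then G contains an induced path on at least c · (log log n)/(log d) vertices. -/
/-- A graph is `d`-degenerate if every subgraph contains a vertex of degree at most `d`:
equivalently, every nonempty set `A` of vertices contains a vertex with at most `d`
neighbours inside `A`. -/
def Degenerate {V : Type*} (G : SimpleGraph V) [DecidableRel G.Adj] (d : ℕ) : Prop :=
  ∀ A : Finset V, A.Nonempty → ∃ v ∈ A, (A.filter fun u => G.Adj v u).card ≤ d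

/-- `G` has a Hamilton path: an ordering of all the vertices in which consecutive vertices
are adjacent. -/
def HasHamiltonPath {V : Type*} [Fintype V] (G : SimpleGraph V) : Prop :=
  ∃ f : Fin (Fintype.card V) → V, Function.Bijective f ∧
    ∀ i j : Fin (Fintype.card V), (j : ℕ) = (i : ℕ) + 1 → G.Adj (f i) (f j)

/-- A degenerate graph has an orientation of bounded out-degree on every finite vertex set. -/
lemma Degenerate.exists_orientation_on {V : Type*} [DecidableEq V] {G : SimpleGraph V}
    [DecidableRel G.Adj] {d : ℕ} (hG : Degenerate G d) (A : Finset V) :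
    ∃ out : V → Finset V, (∀ v, (out v).card ≤ d) ∧
      ∀ u ∈ A, ∀ v ∈ A, G.Adj u v → v ∈ out u ∨ u ∈ out v := by
  induction A using Finset.strongInduction with
  | H A ih =>
    rcases A.eq_empty_or_nonempty with rfl | hA
    · exact ⟨fun _ => ∅, by simp, by simp⟩
    obtain ⟨w, hw, hcard⟩ := hG A hA
    obtain ⟨out, hout, hadj⟩ := ih (A.erase w) (Finset.erase_ssubset hw)
    refine ⟨Function.update out w (A.filter fun u => G.Adj w u), fun v => ?_, fun u hu v hv h => ?_⟩
    · by_cases hv : v = w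
      · subst hv
        simpa using hcard
      · simpa [hv] using hout v
    · by_cases huw : u = w
      · subst huw
        left
        simp [hv, h]
      · by_cases hvw : v = w
        · subst hvw
          right
          simp [hu, h.symm]
        · simpa [huw, hvw] using
            hadj u (Finset.mem_erase.2 ⟨huw, hu⟩) v (Finset.mem_erase.2 ⟨hvw, hv⟩) h

/-- A finite digraph of maximum out-degree `D` whose vertices are all reachable from `a` contains
a shortest directed path from `a` whose length is at least logarithmic in the number of vertices. -/
lemma exists_long_shortest_dipath {V : Type*} [Fintype V] [DecidableEq V] (s : V → Finset V)
    {D : ℕ} (hD : ∀ v, (s v).card ≤ D) (a : V)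
    (ha : ∀ v, Relation.ReflTransGen (fun u w => w ∈ s u) a v) :
    ∃ L, Fintype.card V ≤ (D + 1) ^ L ∧ ∃ x : ℕ → V, x 0 = a ∧
      (∀ i < L, x (i + 1) ∈ s (x i)) ∧
      (∀ i ≤ L, ∀ j ≤ L, x j ∈ s (x i) → j ≤ i + 1) ∧
      ∀ i ≤ L, ∀ j ≤ L, x i = x j → i = j := by
  obtain ⟨B, hB0, hBs⟩ : ∃ B : ℕ → Finset V, B 0 = {a} ∧
      ∀ k, B (k + 1) = B k ∪ (B k).biUnion s :=
    ⟨fun k => Nat.rec {a} (fun _ S => S ∪ S.biUnion s) k, rfl, fun _ => rfl⟩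
  have hcard : ∀ k, (B k).card ≤ (D + 1) ^ k := by
    intro k
    induction k with
    | zero => simp [hB0]
    | succ k ih =>
      have h2 := Finset.card_biUnion_le_card_mul (B k) s D fun v _ => hD v
      calc (B (k + 1)).card ≤ (B k).card + ((B k).biUnion s).card := by
            rw [hBs]; exact Finset.card_union_le _ _
        _ ≤ (B k).card * (D + 1) := by linarith
        _ ≤ (D + 1) ^ (k + 1) := by rw [pow_succ]; gcongr
  have hmono : Monotone B := monotone_nat_of_le_succ fun k => by
    rw [hBs]; exact Finset.subset_union_left
  have hstep : ∀ k u v, u ∈ B k → v ∈ s u → v ∈ B (k + 1) := fun k u v hu hv => by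
    rw [hBs]; exact Finset.mem_union_right _ (Finset.mem_biUnion.2 ⟨u, hu, hv⟩)
  have hex : ∀ v, ∃ k, v ∈ B k := by
    intro v
    induction ha v with
    | refl => exact ⟨0, by simp [hB0]⟩
    | tail _ h ih =>
      obtain ⟨k, hk⟩ := ih
      exact ⟨k + 1, hstep k _ _ hk h⟩
  let dist : V → ℕ := fun v => Nat.find (hex v)
  have hdist : ∀ v, v ∈ B (dist v) := fun v => Nat.find_spec (hex v)
  have hle : ∀ v k, v ∈ B k → dist v ≤ k := fun v k h => Nat.find_min' (hex v) h
  have hdist_succ : ∀ u v, v ∈ s u → dist v ≤ dist u + 1 := fun u v h =>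
    hle v _ (hstep _ u v (hdist u) h)
  have hpath : ∀ k v, dist v = k → ∃ x : ℕ → V, (∀ i < k, x (i + 1) ∈ s (x i)) ∧
      (∀ i ≤ k, dist (x i) = i) ∧ x k = v := by
    intro k
    induction k with
    | zero =>
      intro v hv
      exact ⟨fun _ => v, by simp, fun i hi => by simp_all, rfl⟩
    | succ k ih =>
      intro v hv
      have hvB := hdist v
      rw [hv, hBs, Finset.mem_union, Finset.mem_biUnion] at hvB
      rcases hvB with h | ⟨u, hu, huv⟩
      · have := hle v k h
        omega
      · have h1 := hle u k hu
        have h2 := hdist_succ u v huv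
        obtain ⟨x, hx, hxd, hxk⟩ := ih u (by omega)
        refine ⟨fun i => if i ≤ k then x i else v, fun i hi => ?_, fun i hi => ?_, by simp⟩
        · rcases Nat.lt_succ_iff_lt_or_eq.1 hi with h | rfl
          · simpa [h.le, Nat.succ_le_of_lt h] using hx i h
          · simpa [hxk] using huv
        · by_cases h : i ≤ k
          · simpa [h] using hxd i h
          · have : i = k + 1 := by omega
            simpa [h, this] using hv
  obtain ⟨v, -, hv⟩ := Finset.exists_max_image Finset.univ dist ⟨a, Finset.mem_univ a⟩
  obtain ⟨x, hx, hxd, -⟩ := hpath (dist v) v rfl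
  refine ⟨dist v, ?_, x, ?_, hx, fun i hi j hj h => ?_, fun i hi j hj h => ?_⟩
  · refine le_trans ?_ (hcard (dist v))
    rw [← Finset.card_univ]
    exact Finset.card_le_card fun w hw => hmono (hv w hw) (hdist w)
  · have h0 := hdist (x 0)
    rw [hxd 0 (Nat.zero_le _), hB0] at h0
    simpa using h0
  · have := hdist_succ _ _ h
    rwa [hxd i hi, hxd j hj] at this
  · rw [← hxd i hi, ← hxd j hj, h]

/-- A `d`-degenerate graph with a Hamilton path has an induced path whose number of vertices is
at least doubly logarithmic in the order of the graph. -/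
lemma Degenerate.exists_inducedPath {V : Type*} [Fintype V] [Nonempty V] {G : SimpleGraph V}
    [DecidableRel G.Adj] {d : ℕ} (hG : Degenerate G d) (hP : HasHamiltonPath G) :
    ∃ L M : ℕ, Fintype.card V ≤ (d + 2) ^ L ∧ L + 1 ≤ (d + 2) ^ M ∧
      HasInducedPathOn G (M + 1) := by
  classical
  obtain ⟨out, hout, hadj⟩ := hG.exists_orientation_on Finset.univ
  replace hadj : ∀ u v, G.Adj u v → v ∈ out u ∨ u ∈ out v := fun u v =>
    hadj u (Finset.mem_univ u) v (Finset.mem_univ v)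
  obtain ⟨f, hf, hfadj⟩ := hP
  have hpos : 0 < Fintype.card V := Fintype.card_pos
  let succ : V → Finset V := fun u =>
    Finset.univ.filter fun w => ∃ i j, f i = u ∧ f j = w ∧ (j : ℕ) = i + 1
  have hsucc : ∀ u, (succ u).card ≤ 1 := by
    intro u
    refine Finset.card_le_one.2 fun v hv w hw => ?_
    obtain ⟨i, j, hi, rfl, hij⟩ := (Finset.mem_filter.1 hv).2
    obtain ⟨i', j', hi', rfl, hij'⟩ := (Finset.mem_filter.1 hw).2
    obtain rfl := hf.1 (hi.trans hi'.symm)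
    exact congrArg f (Fin.ext (hij.trans hij'.symm))
  have hsucc_adj : ∀ u, ∀ w ∈ succ u, G.Adj u w := by
    intro u w hw
    obtain ⟨i, j, rfl, rfl, hij⟩ := (Finset.mem_filter.1 hw).2
    exact hfadj i j hij
  let s : V → Finset V := fun u => (out u).filter (G.Adj u) ∪ succ u
  have hs : ∀ u, (s u).card ≤ d + 1 := fun u =>
    (Finset.card_union_le _ _).trans
      (add_le_add ((Finset.card_filter_le _ _).trans (hout u)) (hsucc u))
  have hs_adj : ∀ u, ∀ w ∈ s u, G.Adj u w := by
    intro u w hw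
    rcases Finset.mem_union.1 hw with h | h
    · exact (Finset.mem_filter.1 h).2
    · exact hsucc_adj u w h
  have hreach : ∀ v, Relation.ReflTransGen (fun u w => w ∈ s u) (f ⟨0, hpos⟩) v := by
    intro v
    obtain ⟨⟨i, hi⟩, rfl⟩ := hf.2 v
    induction i with
    | zero => exact .refl
    | succ i ih =>
      refine .tail (ih (Nat.lt_of_succ_lt hi)) (Finset.mem_union_right _ ?_)
      exact Finset.mem_filter.2 ⟨Finset.mem_univ _, _, _, rfl, rfl, rfl⟩
  obtain ⟨L, hL, x, -, hxs, hxshort, hxinj⟩ := exists_long_shortest_dipath s hs _ hreach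
  let t : Fin (L + 1) → Finset (Fin (L + 1)) := fun i =>
    Finset.univ.filter fun j => j < i ∧ G.Adj (x i) (x j)
  have ht : ∀ i, (t i).card ≤ d + 1 := by
    intro i
    have hsub : t i ⊆ (Finset.univ.filter fun j : Fin (L + 1) => x j ∈ out (x i)) ∪
        Finset.univ.filter fun j : Fin (L + 1) => (j : ℕ) + 1 = i := by
      intro j hj
      obtain ⟨-, hji, hij⟩ := Finset.mem_filter.1 hj
      rcases hadj _ _ hij with h | h
      · exact Finset.mem_union_left _ (Finset.mem_filter.2 ⟨Finset.mem_univ _, h⟩)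
      · have := hxshort j (by omega) i (by omega)
          (Finset.mem_union_left _ (Finset.mem_filter.2 ⟨h, hij.symm⟩))
        refine Finset.mem_union_right _ (Finset.mem_filter.2 ⟨Finset.mem_univ _, ?_⟩)
        rw [Fin.lt_def] at hji
        omega
    refine (Finset.card_le_card hsub).trans ((Finset.card_union_le _ _).trans (add_le_add ?_ ?_))
    · refine le_trans ?_ (hout (x i))
      refine Finset.card_le_card_of_injOn (fun j : Fin (L + 1) => x j) (fun j hj => ?_) ?_
      · simpa using hj
      · intro j _ k _ h
        exact Fin.ext (hxinj j (by omega) k (by omega) h)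
    · refine Finset.card_le_one.2 fun j hj k hk => Fin.ext ?_
      have hj := (Finset.mem_filter.1 hj).2
      have hk := (Finset.mem_filter.1 hk).2
      omega
  have htreach : ∀ i, Relation.ReflTransGen (fun i j => j ∈ t i) (Fin.last L) i := by
    intro i
    induction i using Fin.reverseInduction with
    | last => exact .refl
    | cast i ih =>
      refine .tail ih (Finset.mem_filter.2 ⟨Finset.mem_univ _, Fin.castSucc_lt_succ, ?_⟩)
      exact (hs_adj _ _ (hxs i i.2)).symm
  obtain ⟨M, hM, y, -, hyt, hyshort, hyinj⟩ := exists_long_shortest_dipath t ht _ htreach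
  rw [Fintype.card_fin] at hM
  have hyanti : ∀ i j, i < j → j ≤ M → y j < y i := by
    intro i j hij
    induction j, hij using Nat.le_induction with
    | base => exact fun h => (Finset.mem_filter.1 (hyt i h)).2.1
    | succ j hj ih =>
      exact fun h => (Finset.mem_filter.1 (hyt j h)).2.1.trans (ih (Nat.le_of_succ_le h))
  refine ⟨L, M, hL, hM, fun i => x (y i), fun i j h => ?_, fun i j hij => ⟨fun h => ?_, fun h => ?_⟩⟩
  · exact Fin.ext (hyinj i (by omega) j (by omega)
      (Fin.ext (hxinj _ (by omega) _ (by omega) h)))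
  · have := hyshort i (by omega) j (by omega)
      (Finset.mem_filter.2 ⟨Finset.mem_univ _, hyanti i j hij (by omega), h⟩)
    rw [Fin.lt_def] at hij
    omega
  · have := (Finset.mem_filter.1 (hyt i (by omega))).2.2
    simpa [h] using this

/-- There exist a constant `c > 0` and a threshold `n₀` such that for every `d ≥ 2` and
`n ≥ n₀`, every `d`-degenerate simple graph on `n` vertices with a Hamilton path contains
an induced path on at least `c · (log log n)/(log d)` vertices. -/
theorem degenerate_induced_path :
    ∃ c : ℝ, 0 < c ∧ ∃ n₀ : ℕ, ∀ d : ℕ, 2 ≤ d → ∀ n : ℕ, n₀ ≤ n →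
      ∀ (V : Type) [Fintype V] (G : SimpleGraph V) [DecidableRel G.Adj],
        Fintype.card V = n → Degenerate G d → HasHamiltonPath G →
          ∃ k : ℕ, HasInducedPathOn G k ∧
            c * (Real.log (Real.log n) / Real.log d) ≤ (k : ℝ) := by
  refine ⟨1 / 2, by norm_num, 2, fun d hd n hn V _ G _ hV hG hP => ?_⟩
  have : Nonempty V := Fintype.card_pos_iff.1 (by omega)
  obtain ⟨L, M, hL, hM, hk⟩ := hG.exists_inducedPath hP
  refine ⟨M + 1, hk, ?_⟩
  rw [hV] at hL
  have hd' : (2 : ℝ) ≤ d := by exact_mod_cast hd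
  have hn' : (2 : ℝ) ≤ n := by exact_mod_cast hn
  have hlogd : 0 < Real.log d := Real.log_pos (by linarith)
  have hlogn : 0 < Real.log n := Real.log_pos (by linarith)
  have hsq : d + 2 ≤ d ^ 2 := by nlinarith
  have hL' : (n : ℝ) ≤ (d : ℝ) ^ (2 * L) := by
    rw [pow_mul]
    exact_mod_cast hL.trans (Nat.pow_le_pow_left hsq L)
  have hM' : (L : ℝ) ≤ (d : ℝ) ^ (2 * M) := by
    rw [pow_mul]
    exact_mod_cast (Nat.le_succ L).trans (hM.trans (Nat.pow_le_pow_left hsq M))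
  have hle : Real.log n ≤ (d : ℝ) ^ (2 * (M + 1)) := by
    calc Real.log n ≤ Real.log ((d : ℝ) ^ (2 * L)) := Real.log_le_log (by linarith) hL'
      _ = 2 * L * Real.log d := by rw [Real.log_pow]; push_cast; ring
      _ ≤ d * (d : ℝ) ^ (2 * M) * d := by
        gcongr
        exact Real.log_le_self (by linarith)
      _ = (d : ℝ) ^ (2 * (M + 1)) := by ring
  have hlog : Real.log (Real.log n) ≤ 2 * (M + 1) * Real.log d := by
    calc Real.log (Real.log n) ≤ Real.log ((d : ℝ) ^ (2 * (M + 1))) := Real.log_le_log hlogn hle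
      _ = 2 * (M + 1) * Real.log d := by rw [Real.log_pow]; push_cast; ring
  have := (div_le_iff₀ hlogd).2 hlog
  push_cast
  linarith
end

section
/- There exists a constant c > 0 such that the following holds for every integer d ≥ 2 and every integer n ≥ 2: if G is a finite directed graph on n vertices with no directed cycle, in which every vertex has outdegree at most d, and which contains a directed Hamilton path, then G contains an induced directed path on at least c · (log n)/(log d) vertices. -/
open Classical in
/-- The set of endpoints of directed walks with exactly `k` arcs starting at `a`. -/
noncomputable def walkLayer {V : Type*} [Fintype V] (r : V → V → Prop) (a : V) : ℕ → Finset V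
  | 0 => {a}
  | k + 1 => (walkLayer r a k).biUnion fun v => Finset.univ.filter (r v)

section walkLayer

variable {V : Type*} [Fintype V] {r : V → V → Prop} {a : V}

theorem mem_walkLayer_succ {k : ℕ} {u : V} :
    u ∈ walkLayer r a (k + 1) ↔ ∃ v ∈ walkLayer r a k, r v u := by
  simp [walkLayer]

theorem card_walkLayer_le [DecidableRel r] {d : ℕ}
    (hd : ∀ v : V, (Finset.univ.filter fun u => r v u).card ≤ d) (k : ℕ) :
    (walkLayer r a k).card ≤ d ^ k := by
  classical
  induction k with
  | zero => simp [walkLayer]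
  | succ k ih =>
    refine (Finset.card_biUnion_le_card_mul _ _ d fun v _ => ?_).trans ?_
    · convert hd v
    · rw [pow_succ]
      exact Nat.mul_le_mul_right d ih

theorem mem_walkLayer_add {p : ℕ → V} {m s t : ℕ}
    (hp : ∀ i < s + t, r (p i) (p (i + 1))) (h : p s ∈ walkLayer r a m) :
    p (s + t) ∈ walkLayer r a (m + t) := by
  induction t with
  | zero => exact h
  | succ t ih =>
    exact mem_walkLayer_succ.2 ⟨_, ih fun i hi => hp i (by omega), hp _ (by omega)⟩

theorem exists_walk_of_mem_walkLayer {m : ℕ} {v : V} (h : v ∈ walkLayer r a m) :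
    ∃ p : ℕ → V, p 0 = a ∧ p m = v ∧ ∀ i < m, r (p i) (p (i + 1)) := by
  induction m generalizing v with
  | zero => exact ⟨fun _ => a, rfl, by simpa [walkLayer, eq_comm] using h, by simp⟩
  | succ m ih =>
    obtain ⟨w, hw, hwv⟩ := mem_walkLayer_succ.1 h
    obtain ⟨p, h0, hm, hp⟩ := ih hw
    refine ⟨fun i => if i ≤ m then p i else v, by simpa using h0, by simp, fun i hi => ?_⟩
    rcases Nat.lt_succ_iff_lt_or_eq.1 hi with hi | rfl
    · simpa [hi.le, Nat.succ_le_of_lt hi] using hp i hi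
    · simpa [hm] using hwv

end walkLayer

theorem transGen_of_walk {V : Type*} {r : V → V → Prop} {p : ℕ → V} {m i j : ℕ}
    (hp : ∀ i < m, r (p i) (p (i + 1))) (hij : i < j) (hj : j ≤ m) :
    Relation.TransGen r (p i) (p j) := by
  induction j, hij using Nat.le_induction with
  | base => exact .single (hp i (by omega))
  | succ j hij ih => exact (ih (by omega)).tail (hp j (by omega))

/-- In an acyclic digraph, a shortest directed walk is an induced directed path. -/
theorem exists_induced_path_of_mem_walkLayer {V : Type*} [Fintype V] {r : V → V → Prop} {a v : V}
    (hac : ∀ v : V, ¬ Relation.TransGen r v v) {m : ℕ} (hv : v ∈ walkLayer r a m)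
    (hmin : ∀ j < m, v ∉ walkLayer r a j) :
    ∃ f : Fin (m + 1) → V, Function.Injective f ∧
      ∀ i j : Fin (m + 1), i < j →
        ((r (f i) (f j) ↔ (j : ℕ) = (i : ℕ) + 1) ∧ ¬ r (f j) (f i)) := by
  obtain ⟨p, h0, hm, hp⟩ := exists_walk_of_mem_walkLayer hv
  have htrans (i j : Fin (m + 1)) (hij : i < j) : Relation.TransGen r (p i) (p j) :=
    transGen_of_walk hp hij (by omega)
  refine ⟨fun i => p i, fun i j hij => ?_, fun i j hij =>
    ⟨⟨fun hr => ?_, fun h => ?_⟩, fun hr => ?_⟩⟩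
  · have hij : p i = p j := hij
    rcases lt_trichotomy i j with h | h | h
    · exact absurd (hij ▸ htrans i j h) (hac _)
    · exact h
    · exact absurd (hij ▸ htrans j i h) (hac _)
  · by_contra hne
    have hlt : (i : ℕ) < j := hij
    have hi : p (0 + i) ∈ walkLayer r a (0 + i) :=
      mem_walkLayer_add (fun k hk => hp k (by omega)) (by simp [walkLayer, h0])
    rw [zero_add] at hi
    have hj : p j ∈ walkLayer r a (i + 1) := mem_walkLayer_succ.2 ⟨_, hi, hr⟩
    have hend : p (j + (m - j)) ∈ walkLayer r a (i + 1 + (m - j)) :=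
      mem_walkLayer_add (fun k hk => hp k (by omega)) hj
    rw [show (j : ℕ) + (m - j) = m by omega, hm] at hend
    exact hmin _ (by omega) hend
  · have := hp i (by omega)
    rwa [← h] at this
  · exact hac _ ((htrans i j hij).tail hr)


/-- There exists a constant `c > 0` such that for every `d ≥ 2` and `n ≥ 2`, every finite
acyclic directed graph on `n` vertices with all outdegrees at most `d` and containing a
directed Hamilton path contains an induced directed path on at least `c · (log n)/(log d)`
vertices. Here a directed graph is given by its arc relation `r`, acyclicity means no vertex
lies on a directed cycle (no `v` with `Relation.TransGen r v v`), and an induced directed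
path is a sequence of distinct vertices `u₁, …, u_k` with arcs `u_i → u_{i+1}`, no arcs
between non-consecutive vertices in either direction, and no backward arcs
`u_{i+1} → u_i`. -/
theorem acyclic_digraph_induced_path :
    ∃ c : ℝ, 0 < c ∧ ∀ d : ℕ, 2 ≤ d → ∀ n : ℕ, 2 ≤ n →
      ∀ (V : Type) [Fintype V] (r : V → V → Prop) [DecidableRel r],
        Fintype.card V = n →
        (∀ v : V, ¬ Relation.TransGen r v v) →
        (∀ v : V, (Finset.univ.filter fun u => r v u).card ≤ d) →
        (∃ f : Fin n → V, Function.Bijective f ∧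
            ∀ i j : Fin n, (j : ℕ) = (i : ℕ) + 1 → r (f i) (f j)) →
        ∃ k : ℕ,
          (∃ f : Fin k → V, Function.Injective f ∧
              ∀ i j : Fin k, i < j →
                ((r (f i) (f j) ↔ (j : ℕ) = (i : ℕ) + 1) ∧ ¬ r (f j) (f i))) ∧
          c * (Real.log n / Real.log d) ≤ (k : ℝ) := by
  classical
  refine ⟨1, one_pos, fun d hd n hn V _ r _ hcard hac hout ⟨f, hf, hpath⟩ => ?_⟩
  let a : V := f ⟨0, by omega⟩
  have hreach (i : ℕ) (hi : i < n) : f ⟨i, hi⟩ ∈ walkLayer r a i := by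
    induction i with
    | zero => simp [walkLayer, a]
    | succ i ih => exact mem_walkLayer_succ.2 ⟨_, ih (by omega), hpath _ _ rfl⟩
  have hcover : ∃ k, ∀ v : V, ∃ i < k, v ∈ walkLayer r a i := by
    refine ⟨n, fun v => ?_⟩
    obtain ⟨i, rfl⟩ := hf.surjective v
    exact ⟨i, i.2, hreach i i.2⟩
  obtain ⟨k, hk, hmin⟩ : ∃ k, (∀ v : V, ∃ i < k, v ∈ walkLayer r a i) ∧
      ∀ j < k, ¬ ∀ v : V, ∃ i < j, v ∈ walkLayer r a i :=
    ⟨Nat.find hcover, Nat.find_spec hcover, fun _ => Nat.find_min hcover⟩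
  obtain ⟨m, rfl⟩ : ∃ m, k = m + 1 := by
    obtain ⟨i, hi, -⟩ := hk a
    exact ⟨k - 1, by omega⟩
  refine ⟨m + 1, ?_, ?_⟩
  · have hfar := hmin m (by omega)
    push Not at hfar
    obtain ⟨v, hv⟩ := hfar
    obtain ⟨i, hi, hvi⟩ := hk v
    obtain rfl : i = m := by
      by_contra hne
      exact hv i (by omega) hvi
    exact exists_induced_path_of_mem_walkLayer hac hvi hv
  · have hlt : n < d ^ (m + 1) := by
      calc n = (Finset.univ : Finset V).card := by rw [Finset.card_univ, hcard]
        _ ≤ ((Finset.range (m + 1)).biUnion (walkLayer r a)).card :=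
          Finset.card_le_card fun v _ => by simpa using hk v
        _ ≤ ∑ i ∈ Finset.range (m + 1), d ^ i :=
          Finset.card_biUnion_le.trans (Finset.sum_le_sum fun i _ => card_walkLayer_le hout i)
        _ < d ^ (m + 1) := Nat.geomSum_lt hd fun i hi => Finset.mem_range.1 hi
    have hlog : 0 < Real.log d := Real.log_pos (by exact_mod_cast hd)
    rw [one_mul, div_le_iff₀ hlog, ← Real.log_pow]
    exact Real.log_le_log (by positivity) (by exact_mod_cast hlt.le)
end
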